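/- Let I be an ad-invariant ideal of the symmetric algebra S(𝔞), let V = S(𝔞)/I with the induced 𝔞-action ρ_I, and define η_I : 𝔞 → End(V) by η_I(x)(y + I) = xy + I. Then: (a) η_I ∈ ℋ_{ρ_I}(S(𝔞)/I) and the kernel of the induced algebra homomorphism (η_I)_S : S(𝔞) → End(V) equals I, so the resulting 𝔞[t]-module V(ρ_I, η_I) satisfies (x⊗t^r)·V = 0 for all x ∈ 𝔞 and r ≥ 2; (b) the assignment I ↦ [V(ρ_I, η_I)] is an injective map from the set 𝔐_S of ad-invariant ideals of S(𝔞) to the set 𝓜_2 of isomorphism classes of 𝔞[t]-modules killed by 𝔞⊗t²ℂ[t]; (c) the assignment [V(ρ,η)] ↦ I(ρ,η) = ker η_S is a surjective map 𝓜_2 → 𝔐_S. -/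

import Mathlib

open TensorAlgebra TensorProduct Polynomial

noncomputable section

/-- The graded pieces `F^r(a)` of the free Lie algebra on the vector space `a`,
realized inside the tensor algebra `T(a)`:  `F¹(a) = ι(a)` and `F^{r+1}(a)` is spanned by
the commutators `ι(x) * y - y * ι(x)` with `x ∈ a`, `y ∈ F^r(a)`. -/
def Fr (a : Type*) [LieRing a] [LieAlgebra ℂ a] : ℕ → Submodule ℂ (TensorAlgebra ℂ a)
  | 0 => ⊥
  | 1 => LinearMap.range (TensorAlgebra.ι ℂ (M := a))
  | (r + 2) => Submodule.span ℂ
      {u | ∃ (x : a) (y : TensorAlgebra ℂ a), y ∈ Fr a (r + 1) ∧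
        u = TensorAlgebra.ι ℂ x * y - y * TensorAlgebra.ι ℂ x}

/-- The free Lie algebra `F(a) = ⊕_{r>0} F^r(a)` on the vector space `a`,
as a subspace of the tensor algebra. -/
def FLie (a : Type*) [LieRing a] [LieAlgebra ℂ a] : Submodule ℂ (TensorAlgebra ℂ a) :=
  ⨆ r, Fr a r

/-- `IsTau a τ` says that the linear map `τ` is (a linear extension to `T(a)` of) the canonical
Lie algebra homomorphism `τ : F(a) → a`: it is the identity on `F¹(a) = a` and takes the
commutator bracket of `T(a)` (restricted to `F(a)`) to the bracket of `a`. -/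
def IsTau (a : Type*) [LieRing a] [LieAlgebra ℂ a] (τ : TensorAlgebra ℂ a →ₗ[ℂ] a) : Prop :=
  (∀ x : a, τ (TensorAlgebra.ι ℂ x) = x) ∧
  ∀ r s : ℕ, ∀ u ∈ Fr a r, ∀ v ∈ Fr a s, τ (u * v - v * u) = ⁅τ u, τ v⁆

/-- The current algebra `a[t] = a ⊗ ℂ[t]`, with bracket `⁅x ⊗ f, y ⊗ g⁆ = ⁅x, y⁆ ⊗ fg`. -/
abbrev Cur (a : Type*) [LieRing a] [LieAlgebra ℂ a] : Type _ := Polynomial ℂ ⊗[ℂ] a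

/-- `IsTauT a τ τt` says that the linear map `τt` is (a linear extension to `T(a)` of) the map
`τ[t] : F(a) → a[t]` given by `τ[t](𝐱) = τ(𝐱) ⊗ t^r` for `𝐱 ∈ F^r(a)`. -/
def IsTauT (a : Type*) [LieRing a] [LieAlgebra ℂ a] (τ : TensorAlgebra ℂ a →ₗ[ℂ] a)
    (τt : TensorAlgebra ℂ a →ₗ[ℂ] Cur a) : Prop :=
  ∀ r : ℕ, ∀ u ∈ Fr a r, τt u = ((X : ℂ[X]) ^ r) ⊗ₜ[ℂ] (τ u)

end

noncomputable section

/-- `IsAdT a adT` says that `adT` is the diagonal adjoint action of `a` on its tensor algebra,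
i.e. `adT x` is the derivation of `T(a)` with `adT x (ι y) = ι ⁅x, y⁆`. -/
def IsAdT (a : Type*) [LieRing a] [LieAlgebra ℂ a]
    (adT : a →ₗ[ℂ] Module.End ℂ (TensorAlgebra ℂ a)) : Prop :=
  (∀ x : a, adT x 1 = 0) ∧
  (∀ x y : a, adT x (TensorAlgebra.ι ℂ y) = TensorAlgebra.ι ℂ ⁅x, y⁆) ∧
  (∀ (x : a) (u v : TensorAlgebra ℂ a), adT x (u * v) = adT x u * v + u * adT x v)

/-- The bracket of the semidirect product `𝔉 = a ⊕ F(a)`, written on the ambient space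
`a × T(a)`:  `⁅(x, 𝐲), (x', 𝐲')⁆ = (⁅x,x'⁆, adT x 𝐲' - adT x' 𝐲 + (𝐲𝐲' - 𝐲'𝐲))`. -/
def Fbr (a : Type*) [LieRing a] [LieAlgebra ℂ a]
    (adT : a →ₗ[ℂ] Module.End ℂ (TensorAlgebra ℂ a))
    (p q : a × TensorAlgebra ℂ a) : a × TensorAlgebra ℂ a :=
  (⁅p.1, q.1⁆, adT p.1 q.2 - adT q.1 p.2 + (p.2 * q.2 - q.2 * p.2))

/-- The extension of `τ[t]` to `𝔉 = a ⊕ F(a)`, sending `(x, 𝐲)` to `x ⊗ 1 + τ[t](𝐲)`. -/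
def PhiF (a : Type*) [LieRing a] [LieAlgebra ℂ a]
    (τt : TensorAlgebra ℂ a →ₗ[ℂ] Cur a) (p : a × TensorAlgebra ℂ a) : Cur a :=
  (1 : ℂ[X]) ⊗ₜ[ℂ] p.1 + τt p.2

end

noncomputable section

/-- `MemH a V τ ρ η`, i.e. `(ρ, η) ∈ ℋ(V)`:  `ρ` is a Lie algebra homomorphism (C1), `η` is a
homomorphism of `a`-modules for the `a`-module structure on `End V` induced by `ρ` (C2), and
`ker τ_r ⊆ ker η^{⊙r}` for all `r > 0` (C3), where `η^{⊙r}` is the restriction to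
`F^r(a) ⊆ T^r(a)` of the algebra homomorphism `η_T : T(a) → End V` extending `η`. -/
def MemH (a : Type*) [LieRing a] [LieAlgebra ℂ a] {V : Type*} [AddCommGroup V] [Module ℂ V]
    (τ : TensorAlgebra ℂ a →ₗ[ℂ] a) (ρ η : a →ₗ[ℂ] Module.End ℂ V) : Prop :=
  (∀ x y : a, ρ ⁅x, y⁆ = ⁅ρ x, ρ y⁆) ∧
  (∀ x y : a, η ⁅x, y⁆ = ⁅ρ x, η y⁆) ∧
  (∀ r : ℕ, ∀ u ∈ Fr a r, τ u = 0 → TensorAlgebra.lift ℂ η u = 0)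

/-- `IsCurHom a ρ₁ η₁ ρ₂ η₂ φ` says that the linear map `φ : V₁ → V₂` is a homomorphism of
`a[t]`-modules from `V₁(ρ₁, η₁)` to `V₂(ρ₂, η₂)`: it intertwines the actions of `x ⊗ 1`
(given by `ρᵢ`) and of `x ⊗ t^r` (given by `ηᵢ^{⊙r}(𝐱)` for `𝐱 ∈ F^r(a)` with `τ_r(𝐱) = x`). -/
def IsCurHom (a : Type*) [LieRing a] [LieAlgebra ℂ a]
    {V1 V2 : Type*} [AddCommGroup V1] [Module ℂ V1] [AddCommGroup V2] [Module ℂ V2]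
    (ρ1 η1 : a →ₗ[ℂ] Module.End ℂ V1) (ρ2 η2 : a →ₗ[ℂ] Module.End ℂ V2)
    (φ : V1 →ₗ[ℂ] V2) : Prop :=
  (∀ x : a, φ ∘ₗ ρ1 x = ρ2 x ∘ₗ φ) ∧
  ∀ r : ℕ, ∀ u ∈ Fr a r,
    φ ∘ₗ (TensorAlgebra.lift ℂ η1 u : Module.End ℂ V1)
      = (TensorAlgebra.lift ℂ η2 u : Module.End ℂ V2) ∘ₗ φ

end

noncomputable section

/-- The defining relation of the symmetric algebra `S(a)` as a quotient of `T(a)`. -/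
inductive SymRel (a : Type*) [LieRing a] [LieAlgebra ℂ a] :
    TensorAlgebra ℂ a → TensorAlgebra ℂ a → Prop
  | comm (x y : a) : SymRel a (TensorAlgebra.ι ℂ x * TensorAlgebra.ι ℂ y)
      (TensorAlgebra.ι ℂ y * TensorAlgebra.ι ℂ x)

/-- The symmetric algebra `S(a)` of the vector space `a`. -/
abbrev SymmAlg (a : Type*) [LieRing a] [LieAlgebra ℂ a] : Type _ := RingQuot (SymRel a)

/-- The canonical projection `T(a) → S(a)`. -/
def symMk (a : Type*) [LieRing a] [LieAlgebra ℂ a] :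
    TensorAlgebra ℂ a →ₐ[ℂ] SymmAlg a := RingQuot.mkAlgHom ℂ (SymRel a)

end

universe u

section

variable {a : Type*} [LieRing a] [LieAlgebra ℂ a]

theorem symMk_surjective : Function.Surjective (symMk a) :=
  RingQuot.mkAlgHom_surjective ℂ (SymRel a)

theorem symMk_ι_commute (x y : a) :
    Commute (symMk a (TensorAlgebra.ι ℂ x)) (symMk a (TensorAlgebra.ι ℂ y)) := by
  have h := RingQuot.mkAlgHom_rel ℂ (SymRel.comm x y)
  rw [map_mul, map_mul] at h
  exact h

theorem symMk_commute (u v : TensorAlgebra ℂ a) : Commute (symMk a u) (symMk a v) := by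
  have key (x : a) : Commute (symMk a (TensorAlgebra.ι ℂ x)) (symMk a v) := by
    induction v using TensorAlgebra.induction with
    | algebraMap r => rw [AlgHom.commutes]; exact (Algebra.commutes r _).symm
    | ι y => exact symMk_ι_commute x y
    | mul b c hb hc => rw [map_mul]; exact hb.mul_right hc
    | add b c hb hc => rw [map_add]; exact hb.add_right hc
  induction u using TensorAlgebra.induction with
  | algebraMap r => rw [AlgHom.commutes]; exact Algebra.commutes r _
  | ι x => exact key x
  | mul b c hb hc => rw [map_mul]; exact hb.mul_left hc
  | add b c hb hc => rw [map_add]; exact hb.add_left hc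

theorem symMk_eq_zero_of_mem_Fr {r : ℕ} (hr : 2 ≤ r) {u : TensorAlgebra ℂ a} (hu : u ∈ Fr a r) :
    symMk a u = 0 := by
  obtain ⟨k, rfl⟩ := Nat.exists_eq_add_of_le' hr
  rw [Fr] at hu
  induction hu using Submodule.span_induction with
  | mem u hu =>
    obtain ⟨x, y, -, rfl⟩ := hu
    rw [map_sub, map_mul, map_mul, (symMk_commute _ _).eq, sub_self]
  | zero => exact map_zero _
  | add b c _ _ hb hc => rw [map_add, hb, hc, add_zero]
  | smul t b _ hb => rw [map_smul, hb, smul_zero]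

theorem IsAdT.algebraMap {adT : a →ₗ[ℂ] Module.End ℂ (TensorAlgebra ℂ a)} (h : IsAdT a adT)
    (x : a) (r : ℂ) : adT x (algebraMap ℂ (TensorAlgebra ℂ a) r) = 0 := by
  rw [Algebra.algebraMap_eq_smul_one, map_smul, h.1, smul_zero]

theorem IsAdT.lie_apply {adT : a →ₗ[ℂ] Module.End ℂ (TensorAlgebra ℂ a)} (h : IsAdT a adT)
    (x y : a) (u : TensorAlgebra ℂ a) :
    adT ⁅x, y⁆ u = adT x (adT y u) - adT y (adT x u) := by
  induction u using TensorAlgebra.induction with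
  | algebraMap r => simp [h.algebraMap]
  | ι z => simp only [h.2.1, ← map_sub, lie_lie]
  | mul b c hb hc =>
    simp only [h.2.2, map_add, hb, hc]
    noncomm_ring
  | add b c hb hc =>
    simp only [map_add, hb, hc]
    abel

theorem lift_mk_of_mul {I : Submodule ℂ (SymmAlg a)}
    {η : a →ₗ[ℂ] Module.End ℂ (SymmAlg a ⧸ I)}
    (hη : ∀ (x : a) (s : SymmAlg a),
      η x (Submodule.Quotient.mk s) = Submodule.Quotient.mk (symMk a (TensorAlgebra.ι ℂ x) * s))
    (w : TensorAlgebra ℂ a) (s : SymmAlg a) :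
    (TensorAlgebra.lift ℂ η w : Module.End ℂ (SymmAlg a ⧸ I)) (Submodule.Quotient.mk s) =
      Submodule.Quotient.mk (symMk a w * s) := by
  induction w using TensorAlgebra.induction generalizing s with
  | algebraMap r =>
    rw [AlgHom.commutes, AlgHom.commutes, Module.algebraMap_end_apply, ← Algebra.smul_def]
    rfl
  | ι x => rw [TensorAlgebra.lift_ι_apply, hη]
  | mul b c hb hc => rw [map_mul, map_mul, Module.End.mul_apply, hc, hb, mul_assoc]
  | add b c hb hc =>
    rw [map_add, map_add, LinearMap.add_apply, hc, hb, add_mul]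
    rfl

theorem lift_eq_zero_iff {I : Submodule ℂ (SymmAlg a)} (hI : ∀ s : SymmAlg a, ∀ t ∈ I, s * t ∈ I)
    {η : a →ₗ[ℂ] Module.End ℂ (SymmAlg a ⧸ I)}
    (hη : ∀ (x : a) (s : SymmAlg a),
      η x (Submodule.Quotient.mk s) = Submodule.Quotient.mk (symMk a (TensorAlgebra.ι ℂ x) * s))
    (w : TensorAlgebra ℂ a) :
    (TensorAlgebra.lift ℂ η w : Module.End ℂ (SymmAlg a ⧸ I)) = 0 ↔ symMk a w ∈ I := by
  constructor
  · intro h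
    have h1 := lift_mk_of_mul hη w 1
    rw [h, mul_one] at h1
    exact (Submodule.Quotient.mk_eq_zero I).1 h1.symm
  · intro h
    refine LinearMap.ext fun v => ?_
    obtain ⟨s, rfl⟩ := Submodule.Quotient.mk_surjective I v
    obtain ⟨u, rfl⟩ := symMk_surjective s
    rw [lift_mk_of_mul hη, (symMk_commute w u).eq, LinearMap.zero_apply,
      Submodule.Quotient.mk_eq_zero]
    exact hI _ _ h

theorem lift_eq_zero_of_mem_Fr {I : Submodule ℂ (SymmAlg a)}
    (hI : ∀ s : SymmAlg a, ∀ t ∈ I, s * t ∈ I)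
    {η : a →ₗ[ℂ] Module.End ℂ (SymmAlg a ⧸ I)}
    (hη : ∀ (x : a) (s : SymmAlg a),
      η x (Submodule.Quotient.mk s) = Submodule.Quotient.mk (symMk a (TensorAlgebra.ι ℂ x) * s))
    {r : ℕ} (hr : 2 ≤ r) {u : TensorAlgebra ℂ a} (hu : u ∈ Fr a r) :
    (TensorAlgebra.lift ℂ η u : Module.End ℂ (SymmAlg a ⧸ I)) = 0 := by
  rw [lift_eq_zero_iff hI hη, symMk_eq_zero_of_mem_Fr hr hu]
  exact I.zero_mem

theorem memH_quotient {τ : TensorAlgebra ℂ a →ₗ[ℂ] a} (hτ : IsTau a τ)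
    {adT : a →ₗ[ℂ] Module.End ℂ (TensorAlgebra ℂ a)} (hadT : IsAdT a adT)
    {I : Submodule ℂ (SymmAlg a)} (hI : ∀ s : SymmAlg a, ∀ t ∈ I, s * t ∈ I)
    {ρ η : a →ₗ[ℂ] Module.End ℂ (SymmAlg a ⧸ I)}
    (hρ : ∀ (x : a) (u : TensorAlgebra ℂ a),
      ρ x (Submodule.Quotient.mk (symMk a u)) = Submodule.Quotient.mk (symMk a (adT x u)))
    (hη : ∀ (x : a) (s : SymmAlg a),
      η x (Submodule.Quotient.mk s) = Submodule.Quotient.mk (symMk a (TensorAlgebra.ι ℂ x) * s)) :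
    MemH a τ ρ η := by
  refine ⟨fun x y => ?_, fun x y => ?_, fun r u hu h0 => ?_⟩
  · refine LinearMap.ext fun v => ?_
    obtain ⟨s, rfl⟩ := Submodule.Quotient.mk_surjective I v
    obtain ⟨u, rfl⟩ := symMk_surjective s
    rw [Ring.lie_def, LinearMap.sub_apply, Module.End.mul_apply, Module.End.mul_apply,
      hρ, hρ, hρ, hρ, hρ, ← Submodule.Quotient.mk_sub, ← map_sub,
      hadT.lie_apply]
  · refine LinearMap.ext fun v => ?_
    obtain ⟨s, rfl⟩ := Submodule.Quotient.mk_surjective I v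
    obtain ⟨u, rfl⟩ := symMk_surjective s
    rw [Ring.lie_def, LinearMap.sub_apply, Module.End.mul_apply, Module.End.mul_apply,
      hη, hη, hρ, hη, ← map_mul, ← map_mul, ← map_mul, hρ,
      ← Submodule.Quotient.mk_sub, ← map_sub, hadT.2.2, hadT.2.1, add_sub_cancel_right]
  · match r, hu with
    | 0, hu =>
      rw [Fr, Submodule.mem_bot] at hu
      rw [hu, map_zero]
    | 1, hu =>
      rw [Fr] at hu
      obtain ⟨x, rfl⟩ := hu
      rw [hτ.1] at h0
      rw [h0, map_zero, map_zero]
    | k + 2, hu => exact lift_eq_zero_of_mem_Fr hI hη (Nat.le_add_left 2 k) hu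

theorem lift_comp_of_isCurHom {V₁ V₂ : Type*} [AddCommGroup V₁] [Module ℂ V₁]
    [AddCommGroup V₂] [Module ℂ V₂] {ρ₁ η₁ : a →ₗ[ℂ] Module.End ℂ V₁}
    {ρ₂ η₂ : a →ₗ[ℂ] Module.End ℂ V₂} {φ : V₁ →ₗ[ℂ] V₂} (hφ : IsCurHom a ρ₁ η₁ ρ₂ η₂ φ)
    (w : TensorAlgebra ℂ a) :
    φ ∘ₗ (TensorAlgebra.lift ℂ η₁ w : Module.End ℂ V₁) =
      (TensorAlgebra.lift ℂ η₂ w : Module.End ℂ V₂) ∘ₗ φ := by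
  induction w using TensorAlgebra.induction with
  | algebraMap r =>
    refine LinearMap.ext fun v => ?_
    simp
  | ι x => exact hφ.2 1 _ (by rw [Fr]; exact ⟨x, rfl⟩)
  | mul b c hb hc =>
    rw [map_mul, map_mul, Module.End.mul_eq_comp, Module.End.mul_eq_comp, ← LinearMap.comp_assoc,
      hb, LinearMap.comp_assoc, hc, LinearMap.comp_assoc]
  | add b c hb hc => rw [map_add, map_add, LinearMap.comp_add, LinearMap.add_comp, hb, hc]

theorem eq_of_isCurHom {I₁ I₂ : Submodule ℂ (SymmAlg a)}
    (hI₁ : ∀ s : SymmAlg a, ∀ t ∈ I₁, s * t ∈ I₁) (hI₂ : ∀ s : SymmAlg a, ∀ t ∈ I₂, s * t ∈ I₂)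
    {ρ₁ η₁ : a →ₗ[ℂ] Module.End ℂ (SymmAlg a ⧸ I₁)} {ρ₂ η₂ : a →ₗ[ℂ] Module.End ℂ (SymmAlg a ⧸ I₂)}
    (hη₁ : ∀ (x : a) (s : SymmAlg a),
      η₁ x (Submodule.Quotient.mk s) = Submodule.Quotient.mk (symMk a (TensorAlgebra.ι ℂ x) * s))
    (hη₂ : ∀ (x : a) (s : SymmAlg a),
      η₂ x (Submodule.Quotient.mk s) = Submodule.Quotient.mk (symMk a (TensorAlgebra.ι ℂ x) * s))
    (φ : (SymmAlg a ⧸ I₁) ≃ₗ[ℂ] (SymmAlg a ⧸ I₂))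
    (hφ : IsCurHom a ρ₁ η₁ ρ₂ η₂ φ.toLinearMap) : I₁ = I₂ := by
  ext s
  obtain ⟨w, rfl⟩ := symMk_surjective s
  rw [← lift_eq_zero_iff hI₁ hη₁, ← lift_eq_zero_iff hI₂ hη₂]
  have h := lift_comp_of_isCurHom hφ w
  constructor <;> intro h0
  · rw [h0, LinearMap.comp_zero] at h
    refine LinearMap.ext fun v => ?_
    obtain ⟨v, rfl⟩ := φ.surjective v
    exact (LinearMap.congr_fun h v).symm
  · rw [h0, LinearMap.zero_comp] at h
    refine LinearMap.ext fun v => ?_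
    exact (map_eq_zero_iff φ φ.injective).1 (LinearMap.congr_fun h v)

/-- An action by operators on `M` that preserve the kernel of a surjection `q` descends along `q`. -/
theorem exists_descend_of_surjective {R A M N : Type*} [CommRing R] [AddCommGroup A] [Module R A]
    [AddCommGroup M] [Module R M] [AddCommGroup N] [Module R N]
    (q : M →ₗ[R] N) (hq : Function.Surjective q) (f : A →ₗ[R] Module.End R M)
    (hf : ∀ x u, q u = 0 → q (f x u) = 0) :
    ∃ ρ : A →ₗ[R] Module.End R N, ∀ x u, ρ x (q u) = q (f x u) := by
  have hker (x : A) : LinearMap.ker q ≤ LinearMap.ker (q ∘ₗ f x) := fun u hu => hf x u hu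
  let e := q.quotKerEquivOfSurjective hq
  have he (u : M) : e.symm (q u) = Submodule.Quotient.mk u :=
    e.symm_apply_eq.2 rfl
  refine ⟨
    { toFun := fun x => (LinearMap.ker q).liftQ (q ∘ₗ f x) (hker x) ∘ₗ e.symm.toLinearMap
      map_add' := fun x y => ?_
      map_smul' := fun c x => ?_ }, fun x u => ?_⟩
  · refine LinearMap.ext fun v => ?_
    obtain ⟨u, rfl⟩ := hq v
    simp [he]
  · refine LinearMap.ext fun v => ?_
    obtain ⟨u, rfl⟩ := hq v
    simp [he]
  · simp [he]

end

/-- Let `I` be an `ad`-invariant ideal of the symmetric algebra `S(a)`,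
`V = S(a)/I` with the induced `a`-action `ρ_I`, and `η_I(x)(y + I) = xy + I`.  Then:
(a) `η_I ∈ ℋ_{ρ_I}(S(a)/I)`, the kernel of the induced algebra homomorphism
`(η_I)_S : S(a) → End V` is `I` (equivalently, `ker (η_I)_T` is the preimage of `I` in `T(a)`),
and the resulting `a[t]`-module is killed by `x ⊗ t^r` for all `r ≥ 2`;
(b) `I ↦ [V(ρ_I, η_I)]` is injective on `ad`-invariant ideals of `S(a)`;
(c) `[V(ρ,η)] ↦ ker η_S` is surjective from `𝓜₂` onto the `ad`-invariant ideals of `S(a)`. -/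
theorem statement10 (a : Type u) [LieRing a] [LieAlgebra ℂ a]
    (h𝔞 : Submodule.span ℂ {z : a | ∃ x y : a, z = ⁅x, y⁆} = ⊤)
    (τ : TensorAlgebra ℂ a →ₗ[ℂ] a) (hτ : IsTau a τ)
    (τt : TensorAlgebra ℂ a →ₗ[ℂ] Cur a) (hτt : IsTauT a τ τt)
    (adT : a →ₗ[ℂ] Module.End ℂ (TensorAlgebra ℂ a)) (hadT : IsAdT a adT) :
    -- (a)
    (∀ (I : Submodule ℂ (SymmAlg a))
      (_ : ∀ (s : SymmAlg a), ∀ t ∈ I, s * t ∈ I)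
      (_ : ∀ (x : a) (u : TensorAlgebra ℂ a), symMk a u ∈ I → symMk a (adT x u) ∈ I)
      (ρI ηI : a →ₗ[ℂ] Module.End ℂ (SymmAlg a ⧸ I))
      (_ : ∀ (x : a) (u : TensorAlgebra ℂ a),
        ρI x (Submodule.Quotient.mk (symMk a u)) = Submodule.Quotient.mk (symMk a (adT x u)))
      (_ : ∀ (x : a) (s : SymmAlg a),
        ηI x (Submodule.Quotient.mk s) = Submodule.Quotient.mk (symMk a (TensorAlgebra.ι ℂ x) * s)),
      MemH a τ ρI ηI ∧
      (∀ r : ℕ, 2 ≤ r → ∀ u ∈ Fr a r,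
        (TensorAlgebra.lift ℂ ηI u : Module.End ℂ (SymmAlg a ⧸ I)) = 0) ∧
      (∀ w : TensorAlgebra ℂ a,
        ((TensorAlgebra.lift ℂ ηI w : Module.End ℂ (SymmAlg a ⧸ I)) = 0 ↔ symMk a w ∈ I))) ∧
    -- (b) injectivity
    (∀ (I₁ I₂ : Submodule ℂ (SymmAlg a))
      (_ : ∀ (s : SymmAlg a), ∀ t ∈ I₁, s * t ∈ I₁)
      (_ : ∀ (x : a) (u : TensorAlgebra ℂ a), symMk a u ∈ I₁ → symMk a (adT x u) ∈ I₁)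
      (_ : ∀ (s : SymmAlg a), ∀ t ∈ I₂, s * t ∈ I₂)
      (_ : ∀ (x : a) (u : TensorAlgebra ℂ a), symMk a u ∈ I₂ → symMk a (adT x u) ∈ I₂)
      (ρ₁ η₁ : a →ₗ[ℂ] Module.End ℂ (SymmAlg a ⧸ I₁))
      (_ : ∀ (x : a) (u : TensorAlgebra ℂ a),
        ρ₁ x (Submodule.Quotient.mk (symMk a u)) = Submodule.Quotient.mk (symMk a (adT x u)))
      (_ : ∀ (x : a) (s : SymmAlg a),
        η₁ x (Submodule.Quotient.mk s) = Submodule.Quotient.mk (symMk a (TensorAlgebra.ι ℂ x) * s))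
      (ρ₂ η₂ : a →ₗ[ℂ] Module.End ℂ (SymmAlg a ⧸ I₂))
      (_ : ∀ (x : a) (u : TensorAlgebra ℂ a),
        ρ₂ x (Submodule.Quotient.mk (symMk a u)) = Submodule.Quotient.mk (symMk a (adT x u)))
      (_ : ∀ (x : a) (s : SymmAlg a),
        η₂ x (Submodule.Quotient.mk s) = Submodule.Quotient.mk (symMk a (TensorAlgebra.ι ℂ x) * s))
      (φ : (SymmAlg a ⧸ I₁) ≃ₗ[ℂ] (SymmAlg a ⧸ I₂))
      (_ : IsCurHom a ρ₁ η₁ ρ₂ η₂ φ.toLinearMap),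
      I₁ = I₂) ∧
    -- (c) surjectivity
    (∀ (I : Submodule ℂ (SymmAlg a))
      (_ : ∀ (s : SymmAlg a), ∀ t ∈ I, s * t ∈ I)
      (_ : ∀ (x : a) (u : TensorAlgebra ℂ a), symMk a u ∈ I → symMk a (adT x u) ∈ I),
      ∃ (V : Type u) (_ : AddCommGroup V) (_ : Module ℂ V)
        (ρ η : a →ₗ[ℂ] Module.End ℂ V),
        MemH a τ ρ η ∧
        (∀ r : ℕ, 2 ≤ r → ∀ u ∈ Fr a r, (TensorAlgebra.lift ℂ η u : Module.End ℂ V) = 0) ∧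
        (∀ w : TensorAlgebra ℂ a,
          ((TensorAlgebra.lift ℂ η w : Module.End ℂ V) = 0 ↔ symMk a w ∈ I))) := by
  refine ⟨fun I hI _ ρ η hρ hη => ⟨memH_quotient hτ hadT hI hρ hη,
      fun r hr u hu => lift_eq_zero_of_mem_Fr hI hη hr hu, lift_eq_zero_iff hI hη⟩,
    fun I₁ I₂ hI₁ _ hI₂ _ ρ₁ η₁ _ hη₁ ρ₂ η₂ _ hη₂ φ hφ =>
      eq_of_isCurHom hI₁ hI₂ hη₁ hη₂ φ hφ, fun I hI hinv => ?_⟩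
  obtain ⟨ρ, hρ⟩ := exists_descend_of_surjective (I.mkQ ∘ₗ (symMk a).toLinearMap)
    (I.mkQ_surjective.comp symMk_surjective) adT fun x u hu =>
      (Submodule.Quotient.mk_eq_zero I).2 (hinv x u ((Submodule.Quotient.mk_eq_zero I).1 hu))
  obtain ⟨η, hη⟩ := exists_descend_of_surjective I.mkQ I.mkQ_surjective
    (LinearMap.mul ℂ (SymmAlg a) ∘ₗ (symMk a).toLinearMap ∘ₗ TensorAlgebra.ι ℂ) fun x s hs =>
      (Submodule.Quotient.mk_eq_zero I).2 (hI _ s ((Submodule.Quotient.mk_eq_zero I).1 hs))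
  exact ⟨SymmAlg a ⧸ I, inferInstance, inferInstance, ρ, η, memH_quotient hτ hadT hI hρ hη,
    fun r hr u hu => lift_eq_zero_of_mem_Fr hI hη hr hu, lift_eq_zero_iff hI hη⟩
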